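/- Let A be a real m×n matrix and b ∈ ℝᵐ. There exists x ∈ {0,1}ⁿ with A x = b if and only if there exists x ∈ ℝⁿ with A x = b, 0 ≤ x ≤ 1 componentwise, and ‖x − (1/2)·𝟙‖² = n/4, where 𝟙 ∈ ℝⁿ is the all-ones vector and ‖·‖ is the Euclidean norm. -/

import Mathlib

theorem norm_sub_half_smul_one_sq {n : ℕ} (x : EuclideanSpace ℝ (Fin n)) :
    ‖x - (1 / 2 : ℝ) • (WithLp.equiv 2 (Fin n → ℝ)).symm (fun _ => (1 : ℝ))‖ ^ 2 =
      n / 4 - ∑ i, x i * (1 - x i) := by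
  have hcoord : ∀ i : Fin n, (x i - 1 / 2) ^ 2 = 1 / 4 - x i * (1 - x i) := fun i => by ring
  simp only [EuclideanSpace.real_norm_sq_eq, PiLp.sub_apply, PiLp.smul_apply,
    WithLp.equiv_symm_apply, smul_eq_mul, mul_one, hcoord, Finset.sum_sub_distrib,
    Finset.sum_const, Finset.card_univ, Fintype.card_fin, nsmul_eq_mul]
  ring

theorem norm_sub_half_smul_one_sq_eq_iff {n : ℕ} {x : EuclideanSpace ℝ (Fin n)}
    (hx : ∀ i, 0 ≤ x i ∧ x i ≤ 1) :
    ‖x - (1 / 2 : ℝ) • (WithLp.equiv 2 (Fin n → ℝ)).symm (fun _ => (1 : ℝ))‖ ^ 2 = n / 4 ↔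
      ∀ i, x i = 0 ∨ x i = 1 := by
  rw [norm_sub_half_smul_one_sq, sub_eq_self, Finset.sum_eq_zero_iff_of_nonneg
    fun i _ => mul_nonneg (hx i).1 (sub_nonneg.2 (hx i).2)]
  simp [sub_eq_zero, eq_comm (a := (1 : ℝ))]

theorem zero_one_feasibility_iff_relaxation_max_distance
    {m n : ℕ} (A : Matrix (Fin m) (Fin n) ℝ) (b : Fin m → ℝ) :
    (∃ x : Fin n → ℝ, (∀ i : Fin n, x i = 0 ∨ x i = 1) ∧ A.mulVec x = b) ↔
      (∃ x : EuclideanSpace ℝ (Fin n),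
        A.mulVec x = b ∧ (∀ i : Fin n, 0 ≤ x i ∧ x i ≤ 1) ∧
        ‖x - (1 / 2 : ℝ) • (WithLp.equiv 2 (Fin n → ℝ)).symm (fun _ => (1 : ℝ))‖ ^ 2 = n / 4) := by
  constructor
  · rintro ⟨x, hx, hAx⟩
    have hbox : ∀ i, 0 ≤ WithLp.toLp 2 x i ∧ WithLp.toLp 2 x i ≤ 1 := fun i => by
      rcases hx i with h | h <;> simp [h]
    exact ⟨WithLp.toLp 2 x, hAx, hbox, (norm_sub_half_smul_one_sq_eq_iff hbox).2 hx⟩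
  · rintro ⟨x, hAx, hbox, hnorm⟩
    exact ⟨x, (norm_sub_half_smul_one_sq_eq_iff hbox).1 hnorm, hAx⟩
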